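/- arXiv:1007.1964 — 2 statements merged into one kernel-verified Lean document; each statement's English description precedes it below -/
import Mathlib

section
/- Let A and B be C*-algebras with B of stable rank 1, and let φ, ψ : A → B be *-homomorphisms that are approximately unitarily equivalent (via unitaries in the unitization B~). Suppose that φ(A) and ψ(A) are both contained in a closed hereditary subalgebra C of B. Then φ and ψ are approximately unitarily equivalent via unitaries coming from the unitization of C: for every finite subset F of A and every ε > 0 there exist a scalar λ ∈ ℂ and c ∈ C such that v = λ·1 + c is a unitary of B~ and ‖v* φ(x) v − ψ(x)‖ < ε for all x ∈ F. -/
/-- Two maps into a C*-algebra `B` are approximately unitarily equivalent (via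
unitaries in the minimal unitization `B~`) if on every finite set they can be conjugated
to within `ε` of each other by a unitary of `B~`. -/
def ApproxUnitarilyEquiv {A B : Type*} [NonUnitalCStarAlgebra B]
    (φ ψ : A → B) : Prop :=
  ∀ (F : Finset A) (ε : ℝ), 0 < ε →
    ∃ u ∈ unitary (Unitization ℂ B),
      ∀ x ∈ F, ‖star u * (φ x : Unitization ℂ B) * u - (ψ x : Unitization ℂ B)‖ < ε

/-- A C*-algebra has stable rank one if the invertible elements of its minimal
unitization are dense. -/
def StableRankOne (B : Type*) [NonUnitalCStarAlgebra B] : Prop :=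
  Dense {x : Unitization ℂ B | IsUnit x}

theorem isUnit_one_add_mul_swap {R : Type*} [Ring R] {a b : R} (h : IsUnit (1 + a * b)) :
    IsUnit (1 + b * a) := by
  obtain ⟨c, hc, hc'⟩ := isUnit_iff_exists.mp h
  refine isUnit_iff_exists.mpr ⟨1 - b * c * a, ?_, ?_⟩
  · calc (1 + b * a) * (1 - b * c * a) = 1 + b * a - b * ((1 + a * b) * c) * a := by noncomm_ring
      _ = 1 := by rw [hc]; noncomm_ring
  · calc (1 - b * c * a) * (1 + b * a) = 1 + b * a - b * (c * (1 + a * b)) * a := by noncomm_ring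
      _ = 1 := by rw [hc']; noncomm_ring

/-- If invertible elements are dense, then a product `b * a` can be approximated by invertible
elements of the form `δ • 1 + b * g * a`. -/
theorem exists_isUnit_smul_one_add_mul_mul_near {M : Type*} [NormedRing M] [NormedAlgebra ℂ M]
    [CompleteSpace M] (hM : Dense {x : M | IsUnit x}) (a b : M) {t : ℝ} (ht : 0 < t) :
    ∃ (δ : ℂ) (g : M), IsUnit (δ • (1 : M) + b * g * a) ∧
      ‖δ • (1 : M) + b * g * a - b * a‖ < t := by
  obtain ⟨δ, hδ, hδt⟩ : ∃ δ : ℂ, δ ≠ 0 ∧ ‖δ • (1 : M)‖ < t := by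
    have h : Filter.Tendsto (fun δ : ℂ ↦ ‖δ • (1 : M)‖) (nhdsWithin 0 {0}ᶜ) (nhds 0) := by
      have : Continuous fun δ : ℂ ↦ ‖δ • (1 : M)‖ := by fun_prop
      simpa using (this.tendsto 0).mono_left nhdsWithin_le_nhds
    obtain ⟨δ, h₁, h₂⟩ := ((h.eventually_lt_const ht).and self_mem_nhdsWithin).exists
    exact ⟨δ, h₂, h₁⟩
  let a' : M := δ⁻¹ • a
  let r : M → M := fun y ↦ y - a' * b
  have hr : Filter.Tendsto r (nhds (1 + a' * b)) (nhds 1) := by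
    have : Continuous r := by fun_prop
    simpa [r] using this.tendsto (1 + a' * b)
  have hinv : Filter.Tendsto (fun y ↦ Ring.inverse (r y)) (nhds (1 + a' * b)) (nhds 1) := by
    have h := NormedRing.inverse_continuousAt (1 : Mˣ)
    rw [ContinuousAt, Units.val_one, Ring.inverse_one] at h
    exact h.comp hr
  have hlim : Filter.Tendsto (fun y ↦ ‖δ • (1 : M) + b * Ring.inverse (r y) * a - b * a‖)
      (nhds (1 + a' * b)) (nhds ‖δ • (1 : M)‖) := by
    have : Continuous fun g : M ↦ ‖δ • (1 : M) + b * g * a - b * a‖ := by fun_prop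
    simpa [Function.comp_def] using (this.tendsto 1).comp hinv
  have hunit : ∀ᶠ y in nhds (1 + a' * b), IsUnit (r y) :=
    hr.eventually (Units.nhds 1)
  obtain ⟨y, hy, hlt, hry⟩ := ((mem_closure_iff_frequently.mp (hM (1 + a' * b))).and_eventually
    ((hlim.eventually_lt_const hδt).and hunit)).exists
  refine ⟨δ, Ring.inverse (r y), ?_, hlt⟩
  have hy' : y = r y * (1 + Ring.inverse (r y) * a' * b) := by
    rw [mul_add, mul_one, mul_assoc, ← mul_assoc (r y), Ring.mul_inverse_cancel _ hry, one_mul]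
    simp [r]
  have hfac : IsUnit (1 + Ring.inverse (r y) * a' * b) :=
    (hry.mul_left_iff).mp (hy' ▸ hy)
  have hswap := isUnit_one_add_mul_swap hfac
  have : δ • (1 : M) + b * Ring.inverse (r y) * a
      = algebraMap ℂ M δ * (1 + b * (Ring.inverse (r y) * a')) := by
    rw [← Algebra.smul_def, smul_add]
    simp [a', smul_smul, hδ, mul_assoc]
  rw [this]
  exact ((IsUnit.mk0 δ hδ).map (algebraMap ℂ M)).mul hswap

section CStar

variable {M : Type*} [CStarAlgebra M] [PartialOrder M] [StarOrderedRing M]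

/-- Polar decomposition of an invertible element inside a closed star subalgebra. -/
theorem exists_unitary_mul_nonneg (D : StarSubalgebra ℂ M) (hD : IsClosed (D : Set M)) {w : M}
    (hw : IsUnit w) (hwD : w ∈ D) :
    ∃ v ∈ unitary M, v ∈ D ∧ ∃ h : M, 0 ≤ h ∧ w = v * h := by
  have hp : 0 ≤ star w * w := star_mul_self_nonneg w
  have hh : IsUnit (CFC.sqrt (star w * w)) :=
    (CFC.isUnit_sqrt_iff (star w * w)).mpr (hw.star.mul hw)
  have hsq := CFC.sqrt_mul_sqrt_self (star w * w)
  have hn := CFC.sqrt_nonneg (star w * w)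
  have hhD : CFC.sqrt (star w * w) ∈ D := by
    rw [CFC.sqrt_eq_cfc, cfc_nnreal_eq_real _ (star w * w) hp]
    exact cfc_mem (𝕜' := ℂ) (hs := hD) _ (mul_mem (star_mem hwD) hwD)
  set h := CFC.sqrt (star w * w)
  have := hD
  obtain ⟨k, hk⟩ : IsUnit (⟨h, hhD⟩ : D) := by
    rwa [← StarSubalgebra.coe_isUnit]
  have hkh : (↑(k⁻¹) : D).1 * h = 1 := by
    have := congrArg Subtype.val k.inv_mul
    rwa [hk] at this
  have hhk : h * (↑(k⁻¹) : D).1 = 1 := by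
    have := congrArg Subtype.val k.mul_inv
    rwa [hk] at this
  set g : M := (↑(k⁻¹) : D).1
  have hgD : g ∈ D := (↑(k⁻¹) : D).2
  have hgu : IsUnit g := isUnit_iff_exists.mpr ⟨h, hkh, hhk⟩
  have hgs : star g * h = 1 := by
    simpa [hn.isSelfAdjoint.star_eq] using congrArg star hhk
  refine ⟨w * g, (hw.mul hgu).mem_unitary_of_star_mul_self ?_, mul_mem hwD hgD, h, hn, ?_⟩
  · calc star (w * g) * (w * g) = star g * (star w * w) * g := by simp [mul_assoc]
      _ = star g * h * (h * g) := by rw [← hsq]; simp [mul_assoc]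
      _ = 1 := by rw [hgs, hhk, one_mul]
  · rw [mul_assoc, hkh, mul_one]

theorem norm_le_norm_one_add_mul {h : M} (hh : 0 ≤ h) (y : M) : ‖y‖ ≤ ‖(1 + h) * y‖ := by
  have key : star y * y ≤ star ((1 + h) * y) * ((1 + h) * y) := by
    have h2 : 0 ≤ h + h + h * h := by
      have : 0 ≤ h * h := by simpa [hh.isSelfAdjoint.star_eq] using star_mul_self_nonneg h
      positivity
    have h3 := star_left_conjugate_nonneg h2 y
    rw [← sub_nonneg]
    convert h3 using 1
    simp only [star_mul, star_add, star_one, hh.isSelfAdjoint.star_eq]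
    noncomm_ring
  have := CStarAlgebra.norm_le_norm_of_nonneg_of_le (star_mul_self_nonneg y) key
  rw [CStarRing.norm_star_mul_self, CStarRing.norm_star_mul_self] at this
  nlinarith [norm_nonneg y, norm_nonneg ((1 + h) * y)]

theorem norm_mul_sub_self_le {h : M} (hh : 0 ≤ h) (y : M) :
    ‖h * y - y‖ ≤ ‖h * h * y - y‖ := by
  refine (norm_le_norm_one_add_mul hh (h * y - y)).trans_eq (congrArg norm ?_)
  noncomm_ring

theorem norm_self_mul_sub_le {h : M} (hh : 0 ≤ h) (y : M) :
    ‖y * h - y‖ ≤ ‖y * (h * h) - y‖ := by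
  have := norm_mul_sub_self_le hh (star y)
  rw [← norm_star, ← norm_star (h * h * star y - star y)] at this
  simpa [hh.isSelfAdjoint.star_eq] using this

/-- If `e` almost acts as a unit on `P` and `Q`, the unitary `u` almost intertwines `P` and `Q`, and
`v * h` is close to `e * u * e * e` with `v` unitary and `0 ≤ h`, then `v` almost intertwines
`P` and `Q`. -/
theorem norm_mul_unitary_sub_unitary_mul_le [Nontrivial M] {e u v h P Q : M} {t K : ℝ}
    (he : IsSelfAdjoint e) (he1 : ‖e‖ ≤ 1) (hu : u ∈ unitary M) (hv : v ∈ unitary M) (hh : 0 ≤ h)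
    (ht : t ≤ 1) (hPK : ‖P‖ ≤ K) (hQK : ‖Q‖ ≤ K)
    (heP : ‖e * P - P‖ ≤ t) (hPe : ‖P * e - P‖ ≤ t) (heQ : ‖e * Q - Q‖ ≤ t)
    (hQe : ‖Q * e - Q‖ ≤ t) (huPQ : ‖P * u - u * Q‖ ≤ t)
    (hw : ‖v * h - e * u * e * e‖ ≤ t) :
    ‖P * v - v * Q‖ ≤ (36 + 8 * K) * t := by
  have ht0 : 0 ≤ t := (norm_nonneg _).trans heP
  have hK0 : 0 ≤ K := (norm_nonneg _).trans hPK
  have huu : star u * u = 1 := Unitary.star_mul_self_of_mem hu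
  have huu' : u * star u = 1 := Unitary.mul_star_self_of_mem hu
  have hvv : star v * v = 1 := Unitary.star_mul_self_of_mem hv
  have hu1 : ‖u‖ ≤ 1 := (CStarRing.norm_of_mem_unitary hu).le
  have hv1 : ‖v‖ ≤ 1 := (CStarRing.norm_of_mem_unitary hv).le
  have hus1 : ‖star u‖ ≤ 1 := by rwa [norm_star]
  have left {r s : ℝ} {a x : M} (hx : ‖x‖ ≤ s) (ha : ‖a‖ ≤ r) (hr : 0 ≤ r) : ‖a * x‖ ≤ r * s :=
    (norm_mul_le a x).trans (mul_le_mul ha hx (norm_nonneg _) hr)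
  have one_left {s : ℝ} {a x : M} (ha : ‖a‖ ≤ 1) (hx : ‖x‖ ≤ s) : ‖a * x‖ ≤ s := by
    simpa using left hx ha zero_le_one
  have one_right {s : ℝ} {a x : M} (ha : ‖a‖ ≤ 1) (hx : ‖x‖ ≤ s) : ‖x * a‖ ≤ s := by
    simpa using left ha hx ((norm_nonneg _).trans hx)
  obtain ⟨d, hd⟩ : ∃ d, d = v * h - e * u * e * e := ⟨_, rfl⟩
  rw [← hd] at hw
  obtain ⟨w, hwd⟩ : ∃ w, w = v * h := ⟨_, rfl⟩
  have hwz : w = e * u * e * e + d := by rw [hd, hwd]; abel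
  have hws : star w = e * e * star u * e + star d := by
    simp [hwz, he.star_eq, mul_assoc]
  have hds : ‖star d‖ ≤ t := by rwa [norm_star]
  have hw2 : ‖w‖ ≤ 2 := by
    rw [hwz]
    refine (norm_add_le _ _).trans ?_
    have := one_right he1 (one_right he1 (one_right hu1 he1))
    linarith
  have hws2 : ‖star w‖ ≤ 2 := by rwa [norm_star]
  have hwQ : ‖w * Q - u * Q‖ ≤ (5 + K) * t := by
    have : w * Q - u * Q = e * (u * (e * (e * Q - Q))) + e * (u * (e * Q - Q))
        + -(e * (P * u - u * Q)) + (e * P - P) * u + (P * u - u * Q) + d * Q := by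
      rw [hwz]; noncomm_ring
    rw [this]
    refine (norm_add_le_of_le (norm_add_le_of_le (norm_add_le_of_le (norm_add_le_of_le
      (norm_add_le_of_le (one_left he1 (one_left hu1 (one_left he1 heQ)))
        (one_left he1 (one_left hu1 heQ))) ((norm_neg _).trans_le (one_left he1 huPQ)))
      (one_right hu1 heP)) huPQ) (left hQK hw ht0)).trans_eq ?_
    ring
  have hPw : ‖P * w - u * Q‖ ≤ (4 + K) * t := by
    have : P * w - u * Q = (P * e - P) * u * e * e + (P * u - u * Q) * e * e
        + u * ((Q * e - Q) * e) + u * (Q * e - Q) + P * d := by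
      rw [hwz]; noncomm_ring
    rw [this]
    refine (norm_add_le_of_le (norm_add_le_of_le (norm_add_le_of_le (norm_add_le_of_le
      (one_right he1 (one_right he1 (one_right hu1 hPe)))
        (one_right he1 (one_right he1 huPQ))) (one_left hu1 (one_right he1 hQe)))
      (one_left hu1 hQe)) (left hw hPK hK0)).trans_eq ?_
    ring
  have hwwQ : ‖star w * w * Q - Q‖ ≤ (15 + 3 * K) * t := by
    have : star w * w * Q - Q = star w * (w * Q - u * Q) + star d * (u * Q)
        + -(e * (e * (star u * (e * (P * u - u * Q)))))
        + e * (e * (star u * ((e * P - P) * u)))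
        + e * (e * (star u * (P * u - u * Q))) + e * (e * Q - Q) + (e * Q - Q) := by
      have h1 : e * (e * (star u * (P * u - u * Q)))
          = e * e * star u * P * u - e * e * (star u * u) * Q := by noncomm_ring
      have h2 : star w * w * Q = star w * (w * Q - u * Q)
          + (e * e * star u * e + star d) * (u * Q) := by rw [← hws]; noncomm_ring
      rw [h1, huu, h2]
      noncomm_ring
    rw [this]
    refine (norm_add_le_of_le (norm_add_le_of_le (norm_add_le_of_le (norm_add_le_of_le
      (norm_add_le_of_le (norm_add_le_of_le (left hwQ hws2 zero_le_two)
        (left (one_left hu1 hQK) hds ht0)) ((norm_neg _).trans_le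
          (one_left he1 (one_left he1 (one_left hus1 (one_left he1 huPQ))))))
        (one_left he1 (one_left he1 (one_left hus1 (one_right hu1 heP)))))
        (one_left he1 (one_left he1 (one_left hus1 huPQ)))) (one_left he1 heQ)) heQ).trans_eq ?_
    ring
  have hPww : ‖P * (w * star w) - P‖ ≤ (12 + 3 * K) * t := by
    have : P * (w * star w) - P = (P * w - u * Q) * star w + u * Q * star d
        + u * ((Q * e - Q) * e * star u * e) + u * ((Q * e - Q) * star u * e)
        + -((P * u - u * Q) * star u * e) + (P * e - P) := by
      have h1 : (P * u - u * Q) * star u * e = P * (u * star u) * e - u * Q * star u * e := by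
        noncomm_ring
      have h2 : P * (w * star w) = (P * w - u * Q) * star w
          + u * Q * (e * e * star u * e + star d) := by rw [← hws]; noncomm_ring
      rw [h1, huu', h2]
      noncomm_ring
    rw [this]
    refine (norm_add_le_of_le (norm_add_le_of_le (norm_add_le_of_le (norm_add_le_of_le
      (norm_add_le_of_le (left hws2 hPw (by positivity)) (left hds (one_left hu1 hQK) hK0))
        (one_left hu1 (one_right he1 (one_right hus1 (one_right he1 hQe)))))
        (one_left hu1 (one_right he1 (one_right hus1 hQe))))
        ((norm_neg _).trans_le (one_right he1 (one_right hus1 huPQ)))) hPe).trans_eq ?_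
    ring
  have hhh : star w * w = h * h := by
    rw [hwd, star_mul, hh.isSelfAdjoint.star_eq, mul_assoc, ← mul_assoc (star v), hvv, one_mul]
  have hkk : w * star w = (v * h * star v) * (v * h * star v) := by
    calc w * star w = v * h * 1 * h * star v := by
          rw [hwd, star_mul, hh.isSelfAdjoint.star_eq]; noncomm_ring
      _ = _ := by rw [← hvv]; noncomm_ring
  have hvQ : ‖v * (h * Q - Q)‖ ≤ (15 + 3 * K) * t :=
    one_left hv1 ((norm_mul_sub_self_le hh Q).trans (hhh ▸ hwwQ))
  have hPv : ‖(P * (v * h * star v) - P) * v‖ ≤ (12 + 3 * K) * t :=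
    one_right hv1 ((norm_self_mul_sub_le (star_right_conjugate_nonneg hh v) P).trans
      (hkk ▸ hPww))
  have : P * v - v * Q = -((P * (v * h * star v) - P) * v) + (P * w - u * Q)
      + -(w * Q - u * Q) + v * (h * Q - Q) := by
    have h1 : (P * (v * h * star v) - P) * v = P * (v * h) * (star v * v) - P * v := by
      noncomm_ring
    rw [h1, hvv, hwd]
    noncomm_ring
  rw [this]
  refine (norm_add_le_of_le (norm_add_le_of_le (norm_add_le_of_le
    ((norm_neg _).trans_le hPv) hPw) ((norm_neg _).trans_le hwQ)) hvQ).trans_eq ?_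
  ring

end CStar

section Hereditary

variable {B : Type*} [NonUnitalCStarAlgebra B]

/-- The copy of the unitization of `C` inside the unitization of `B`. -/
def NonUnitalStarSubalgebra.unitizationStarSubalgebra (C : NonUnitalStarSubalgebra ℂ B) :
    StarSubalgebra ℂ (Unitization ℂ B) where
  carrier := {m | m.snd ∈ C}
  mul_mem' {x y} hx hy := by
    simpa using add_mem (add_mem (C.smul_mem x.fst hy) (C.smul_mem y.fst hx)) (C.mul_mem hx hy)
  add_mem' {x y} hx hy := by simpa using add_mem hx hy
  algebraMap_mem' r := by simp [Unitization.algebraMap_eq_inl]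
  star_mem' {x} hx := by simpa using star_mem hx

theorem NonUnitalStarSubalgebra.mem_unitizationStarSubalgebra {C : NonUnitalStarSubalgebra ℂ B}
    {m : Unitization ℂ B} : m ∈ C.unitizationStarSubalgebra ↔ m.snd ∈ C := Iff.rfl

theorem NonUnitalStarSubalgebra.isClosed_unitizationStarSubalgebra
    {C : NonUnitalStarSubalgebra ℂ B} (hC : IsClosed (C : Set B)) :
    IsClosed (C.unitizationStarSubalgebra : Set (Unitization ℂ B)) :=
  hC.preimage Unitization.continuous_snd

/-- A closed star subalgebra contains self-adjoint contractions acting almost as a unit on any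
given finite subset. -/
theorem NonUnitalStarSubalgebra.exists_isSelfAdjoint_almost_unit
    (C : NonUnitalStarSubalgebra ℂ B) (hC : IsClosed (C : Set B)) {s : Set B} (hs : s.Finite)
    (hsC : ∀ x ∈ s, x ∈ C) {t : ℝ} (ht : 0 < t) :
    ∃ e ∈ C, IsSelfAdjoint e ∧ ‖e‖ ≤ 1 ∧ ∀ x ∈ s, ‖e * x - x‖ ≤ t ∧ ‖x * e - x‖ ≤ t := by
  have := hC
  let _ : PartialOrder C := CStarAlgebra.spectralOrder C
  have : StarOrderedRing C := CStarAlgebra.spectralOrderedRing C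
  have hau := CStarAlgebra.increasingApproximateUnit C
  have hev : ∀ᶠ e : C in CStarAlgebra.approximateUnit C, ∀ x ∈ s,
      ‖(e : B) * x - x‖ ≤ t ∧ ‖x * (e : B) - x‖ ≤ t := by
    refine (Filter.eventually_all_finite hs).mpr fun x hx ↦ ?_
    have h1 := (hau.tendsto_mul_right ⟨x, hsC x hx⟩).eventually (Metric.closedBall_mem_nhds _ ht)
    have h2 := (hau.tendsto_mul_left ⟨x, hsC x hx⟩).eventually (Metric.closedBall_mem_nhds _ ht)
    filter_upwards [h1, h2] with e h1 h2
    rw [Subtype.dist_eq, dist_eq_norm] at h1 h2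
    exact ⟨h1, h2⟩
  obtain ⟨e, he, hsa, hnorm⟩ :=
    (hev.and (hau.eventually_isSelfAdjoint.and hau.eventually_norm)).exists
  exact ⟨e, e.2, congrArg Subtype.val hsa, hnorm, he⟩

variable [PartialOrder B] [StarOrderedRing B]

theorem mul_mul_mem_of_hereditary {C : NonUnitalStarSubalgebra ℂ B}
    (hC : ∀ x ∈ C, 0 ≤ x → ∀ y : B, 0 ≤ y → y ≤ x → y ∈ C) {e : B} (heC : e ∈ C)
    (he : IsSelfAdjoint e) (b : B) : e * b * e ∈ C := by
  have hb : b ∈ Submodule.span ℂ {a : B | 0 ≤ a} := by simp [CStarAlgebra.span_nonneg]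
  induction hb using Submodule.span_induction with
  | mem x hx =>
    have hx : 0 ≤ x := hx
    have hle := CStarAlgebra.star_left_conjugate_le_norm_smul (a := e) hx.isSelfAdjoint
    have hnn := star_left_conjugate_nonneg hx e
    rw [he.star_eq] at hle hnn
    refine hC _ ?_ (hnn.trans hle) _ hnn hle
    rw [← Complex.coe_smul]
    exact C.smul_mem _ (C.mul_mem heC heC)
  | zero => simp
  | add x y _ _ hx hy => simpa [mul_add, add_mul] using add_mem hx hy
  | smul r x _ hx => simpa [mul_smul_comm, smul_mul_assoc] using C.smul_mem r hx

theorem inr_mul_mul_inr_mem_of_hereditary {C : NonUnitalStarSubalgebra ℂ B}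
    (hC : ∀ x ∈ C, 0 ≤ x → ∀ y : B, 0 ≤ y → y ≤ x → y ∈ C) {e : B} (heC : e ∈ C)
    (he : IsSelfAdjoint e) (m : Unitization ℂ B) :
    (e : Unitization ℂ B) * m * e ∈ C.unitizationStarSubalgebra := by
  rw [NonUnitalStarSubalgebra.mem_unitizationStarSubalgebra]
  have := add_mem (C.smul_mem m.fst (C.mul_mem heC heC)) (mul_mul_mem_of_hereditary hC heC he m.snd)
  simpa [add_mul, smul_mul_assoc] using this

end Hereditary

/-- If `φ, ψ : A → B` are approximately unitarily equivalent ∗-homomorphisms into a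
stable rank one C*-algebra `B`, and both have range inside a closed hereditary
subalgebra `C` of `B`, then they are approximately unitarily equivalent via unitaries
of the form `λ·1 + c` with `c ∈ C`, i.e. unitaries coming from the unitization of `C`. -/
theorem approxUnitarilyEquiv_in_hereditary
    {A B : Type*} [NonUnitalCStarAlgebra A] [NonUnitalCStarAlgebra B]
    [PartialOrder B] [StarOrderedRing B]
    (hB : StableRankOne B)
    (φ ψ : A →⋆ₙₐ[ℂ] B)
    (C : NonUnitalStarSubalgebra ℂ B) (hCclosed : IsClosed (C : Set B))
    (hChered : ∀ x ∈ C, 0 ≤ x → ∀ y : B, 0 ≤ y → y ≤ x → y ∈ C)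
    (hφC : ∀ a : A, φ a ∈ C) (hψC : ∀ a : A, ψ a ∈ C)
    (h : ApproxUnitarilyEquiv (⇑φ) (⇑ψ)) :
    ∀ (F : Finset A) (ε : ℝ), 0 < ε →
      ∃ (lam : ℂ) (c : B), c ∈ C ∧
        (Unitization.inl lam + (c : Unitization ℂ B)) ∈ unitary (Unitization ℂ B) ∧
        ∀ x ∈ F,
          ‖star (Unitization.inl lam + (c : Unitization ℂ B)) *
              (φ x : Unitization ℂ B) * (Unitization.inl lam + (c : Unitization ℂ B)) -
            (ψ x : Unitization ℂ B)‖ < ε := by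
  intro F ε hε
  obtain ⟨K, hK⟩ : ∃ K, K = ∑ x ∈ F, (‖φ x‖ + ‖ψ x‖) := ⟨_, rfl⟩
  have hK0 : 0 ≤ K := hK ▸ by positivity
  have hKle (x) (hx : x ∈ F) : ‖φ x‖ + ‖ψ x‖ ≤ K := hK ▸
    Finset.single_le_sum (f := fun x ↦ ‖φ x‖ + ‖ψ x‖) (fun _ _ ↦ by positivity) hx
  obtain ⟨t, ht0, ht1, htε⟩ : ∃ t : ℝ, 0 < t ∧ t ≤ 1 ∧ (36 + 8 * K) * t < ε := by
    refine ⟨min 1 (ε / (37 + 8 * K)), by positivity, min_le_left _ _, ?_⟩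
    calc (36 + 8 * K) * min 1 (ε / (37 + 8 * K)) ≤ (36 + 8 * K) * (ε / (37 + 8 * K)) := by
          gcongr; exact min_le_right _ _
      _ < (37 + 8 * K) * (ε / (37 + 8 * K)) := by gcongr; norm_num
      _ = ε := by field_simp
  obtain ⟨e, heC, hesa, he1, he⟩ := C.exists_isSelfAdjoint_almost_unit hCclosed
    (s := φ '' F ∪ ψ '' F) ((F.finite_toSet.image φ).union (F.finite_toSet.image ψ))
    (by rintro _ (⟨a, -, rfl⟩ | ⟨a, -, rfl⟩) <;> simp [hφC, hψC]) ht0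
  have hnorm {y : B} (hy : ‖e * y - y‖ ≤ t ∧ ‖y * e - y‖ ≤ t) :
      ‖(e : Unitization ℂ B) * y - y‖ ≤ t ∧ ‖(y : Unitization ℂ B) * e - y‖ ≤ t := by
    simpa [← Unitization.inr_mul, ← Unitization.inr_sub, Unitization.norm_inr] using hy
  obtain ⟨u, hu, hu'⟩ := h F t ht0
  obtain ⟨δ, g, hunit, hnear⟩ :=
    exists_isUnit_smul_one_add_mul_mul_near hB (e : Unitization ℂ B) (e * u * e) ht0
  have hmem : δ • (1 : Unitization ℂ B) + e * u * e * g * e ∈ C.unitizationStarSubalgebra := by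
    refine add_mem (SMulMemClass.smul_mem δ (one_mem _)) ?_
    simpa [mul_assoc] using inr_mul_mul_inr_mem_of_hereditary hChered heC hesa (u * e * g)
  obtain ⟨v, hv, hvC, p, hp, hvp⟩ := exists_unitary_mul_nonneg C.unitizationStarSubalgebra
    (NonUnitalStarSubalgebra.isClosed_unitizationStarSubalgebra hCclosed) hunit hmem
  refine ⟨v.fst, v.snd, hvC, ?_⟩
  rw [Unitization.inl_fst_add_inr_snd_eq]
  refine ⟨hv, fun x hx ↦ ?_⟩
  obtain ⟨heP, hPe⟩ := hnorm (he (φ x) (.inl ⟨x, hx, rfl⟩))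
  obtain ⟨heQ, hQe⟩ := hnorm (he (ψ x) (.inr ⟨x, hx, rfl⟩))
  have huPQ : ‖(φ x : Unitization ℂ B) * u - u * ψ x‖ ≤ t := by
    have heq : (φ x : Unitization ℂ B) * u - u * ψ x = u * (star u * φ x * u - ψ x) := by
      rw [mul_sub, ← mul_assoc, ← mul_assoc, Unitary.mul_star_self_of_mem hu, one_mul]
    rw [heq, CStarRing.norm_mem_unitary_mul _ hu]
    exact (hu' x hx).le
  have hle := norm_mul_unitary_sub_unitary_mul_le (K := K) (hesa.inr ℂ)
    (by rwa [Unitization.norm_inr]) hu hv hp ht1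
    (by rw [Unitization.norm_inr]; linarith [hKle x hx, norm_nonneg (ψ x)])
    (by rw [Unitization.norm_inr]; linarith [hKle x hx, norm_nonneg (φ x)])
    heP hPe heQ hQe huPQ (hvp ▸ hnear.le)
  have heq : star v * (φ x : Unitization ℂ B) * v - ψ x = star v * (φ x * v - v * ψ x) := by
    rw [mul_sub, ← mul_assoc, ← mul_assoc, Unitary.star_mul_self_of_mem hv, one_mul]
  rw [heq, CStarRing.norm_mem_unitary_mul _ (Unitary.star_mem hv)]
  exact hle.trans_lt htε
end

section
/- Let A be a C*-algebra, let p be a projection in M_n(A), and let a be a positive element of M_n(A) such that p is Cuntz subequivalent to a in M_n(A). Then there exist a natural number N and a positive element b of M_N(A) such that diag(p, b) is Cuntz equivalent to diag(a, 0_N) in M_{n+N}(A). (A compact element represented by a projection splits off as a direct summand of any Cuntz class dominating it.) -/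
open Filter Topology Matrix

/-- `a` is Cuntz subequivalent to `b`: there is a sequence `dₙ` with `dₙ b dₙ* → a`. -/
def CuntzSubequivalent {D : Type*} [NonUnitalRing D] [TopologicalSpace D] [Star D]
    (a b : D) : Prop :=
  ∃ d : ℕ → D, Tendsto (fun n => d n * b * star (d n)) atTop (𝓝 a)

/-- Cuntz equivalence: subequivalence in both directions. -/
def CuntzEquivalent {D : Type*} [NonUnitalRing D] [TopologicalSpace D] [Star D]
    (a b : D) : Prop :=
  CuntzSubequivalent a b ∧ CuntzSubequivalent b a

namespace CuntzSubequivalent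

section Topological

variable {D : Type*} [NonUnitalRing D] [TopologicalSpace D] [StarRing D]

theorem mem_closure {a b : D} (h : CuntzSubequivalent a b) :
    a ∈ closure (Set.range fun d : D => d * b * star d) := by
  obtain ⟨d, hd⟩ := h
  exact mem_closure_of_tendsto hd (Eventually.of_forall fun n => ⟨d n, rfl⟩)

theorem of_mem_closure [FrechetUrysohnSpace D] {a b : D}
    (h : a ∈ closure (Set.range fun d : D => d * b * star d)) : CuntzSubequivalent a b := by
  obtain ⟨x, hx, hlim⟩ := mem_closure_iff_seq_limit.1 h
  choose d hd using hx
  exact ⟨d, by simpa only [hd] using hlim⟩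

theorem trans [FrechetUrysohnSpace D] [ContinuousMul D] {a b c : D}
    (hab : CuntzSubequivalent a b) (hbc : CuntzSubequivalent b c) : CuntzSubequivalent a c := by
  obtain ⟨e, he⟩ := hbc
  refine of_mem_closure (closure_minimal ?_ isClosed_closure hab.mem_closure)
  rintro _ ⟨d, rfl⟩
  refine mem_closure_of_tendsto ((he.const_mul d).mul_const (star d))
    (Eventually.of_forall fun n => ⟨d * e n, ?_⟩)
  simp only [star_mul, mul_assoc]

theorem mul_star_of_tendsto [ContinuousMul D] [ContinuousStar D] {x y : D} {d : ℕ → D}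
    (h : Tendsto (fun n => d n * x) atTop (𝓝 y)) :
    CuntzSubequivalent (y * star y) (x * star x) :=
  ⟨d, by simpa only [star_mul, mul_assoc] using h.mul h.star⟩

end Topological

section CStar

variable {D : Type*} [NonUnitalCStarAlgebra D]

/-- The two positive elements attached to `z` satisfy `z z* ≾ z* z`. -/
theorem mul_star_self_star_mul_self (z : D) :
    CuntzSubequivalent (z * star z) (star z * z) := by
  let _ := CStarAlgebra.spectralOrder D
  have _ := CStarAlgebra.spectralOrderedRing D
  set t : D := star z * z with ht
  have ht0 : 0 ≤ t := star_mul_self_nonneg z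
  have hsa : IsSelfAdjoint t := .of_nonneg ht0
  refine of_mem_closure (Metric.mem_closure_iff.2 fun ε hε => ?_)
  obtain ⟨δ, hδ, hδε⟩ : ∃ δ : ℝ, 0 < δ ∧ 2 * δ * ‖z‖ ^ 2 < ε ^ 2 := by
    refine ⟨ε ^ 2 / (4 * (‖z‖ ^ 2 + 1)), by positivity, ?_⟩
    have hz : 0 < ‖z‖ ^ 2 + 1 := by positivity
    have hε2 : 0 < ε ^ 2 := by positivity
    rw [show 2 * (ε ^ 2 / (4 * (‖z‖ ^ 2 + 1))) * ‖z‖ ^ 2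
      = ε ^ 2 * ‖z‖ ^ 2 / (2 * (‖z‖ ^ 2 + 1)) by field_simp; ring, div_lt_iff₀ (by positivity)]
    nlinarith [sq_nonneg ‖z‖]
  have hpos (τ : ℝ) : |τ| + δ ≠ 0 := by positivity
  let f : ℝ → ℝ := fun τ => √τ / (|τ| + δ)
  let g : ℝ → ℝ := fun τ => f τ * τ * f τ
  have hf : Continuous f := by fun_prop (disch := exact hpos _)
  have hf0 : f 0 = 0 := by simp [f]
  have hg : Continuous g := by fun_prop
  have hg0 : g 0 = 0 := by simp [g]
  set r : D := cfcₙ f t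
  set k : D := cfcₙ g t with hk
  have hrsa : star r = r := (cfcₙ_predicate f t : IsSelfAdjoint r)
  have hksa : star k = k := (cfcₙ_predicate g t : IsSelfAdjoint k)
  have hrk : r * t * r = k := by
    rw [hk, cfcₙ_mul (fun τ => f τ * τ) f t (by fun_prop) (by simp) hf.continuousOn hf0,
      cfcₙ_mul f (fun τ => τ) t hf.continuousOn hf0 (by fun_prop) rfl, cfcₙ_id' ℝ t]
  have hnorm : ‖z - z * k‖ ^ 2 ≤ 2 * δ := by
    have hexp : star (z - z * k) * (z - z * k)
        = cfcₙ (fun τ => (τ - g τ * τ) - (τ - g τ * τ) * g τ) t := by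
      rw [cfcₙ_sub (fun τ => τ - g τ * τ) (fun τ => (τ - g τ * τ) * g τ) t (by fun_prop)
          (by simp) (by fun_prop) (by simp),
        cfcₙ_mul (fun τ => τ - g τ * τ) g t (by fun_prop) (by simp) (by fun_prop) hg0,
        cfcₙ_sub (fun τ => τ) (fun τ => g τ * τ) t (by fun_prop) rfl (by fun_prop) (by simp),
        cfcₙ_mul g (fun τ => τ) t (by fun_prop) hg0 (by fun_prop) rfl, cfcₙ_id' ℝ t, ← hk, ht]
      simp only [star_sub, star_mul, hksa]
      noncomm_ring
    rw [sq, ← CStarRing.norm_star_mul_self, hexp]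
    refine norm_cfcₙ_le fun τ hτ => ?_
    have hτ0 : 0 ≤ τ := quasispectrum_nonneg_of_nonneg t ht0 τ hτ
    have hgτ : g τ = (τ / (τ + δ)) ^ 2 := by
      simp only [g, f, abs_of_nonneg hτ0]
      have : √τ * √τ = τ := Real.mul_self_sqrt hτ0
      calc _ = (√τ * √τ) * τ / (τ + δ) ^ 2 := by field_simp
        _ = _ := by rw [this]; field_simp
    have hu0 : 0 ≤ τ / (τ + δ) := by positivity
    have hu1 : τ / (τ + δ) ≤ 1 := (div_le_one (by positivity)).2 (by linarith)
    have hτu : τ * (1 - τ / (τ + δ)) ≤ δ := by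
      rw [one_sub_div (by positivity), ← mul_div_assoc, div_le_iff₀ (by positivity)]
      nlinarith
    set u := τ / (τ + δ)
    rw [hgτ, show τ - u ^ 2 * τ - (τ - u ^ 2 * τ) * u ^ 2
      = (τ * (1 - u)) * ((1 + u) * (1 - u ^ 2)) by ring, Real.norm_of_nonneg]
    · have h1 : (1 + u) * (1 - u ^ 2) ≤ 2 := by nlinarith
      have h2 : 0 ≤ (1 + u) * (1 - u ^ 2) :=
        mul_nonneg (by linarith) (by nlinarith)
      calc _ ≤ δ * 2 := mul_le_mul hτu h1 h2 hδ.le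
        _ = 2 * δ := by ring
    · exact mul_nonneg (mul_nonneg hτ0 (by linarith)) (mul_nonneg (by linarith) (by nlinarith))
  refine ⟨_, ⟨z * r, rfl⟩, ?_⟩
  dsimp only
  rw [dist_eq_norm, star_mul, hrsa,
    show z * star z - z * r * t * (r * star z) = (z - z * k) * star z by
      rw [← hrk]; noncomm_ring]
  refine (norm_mul_le _ _).trans_lt (lt_of_pow_lt_pow_left₀ 2 hε.le ?_)
  rw [mul_pow, norm_star]
  exact (mul_le_mul_of_nonneg_right hnorm (by positivity)).trans_lt hδε

/-- A projection Cuntz below a positive element `a` is exactly of the form `e a e*`. -/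
theorem exists_eq_mul_mul_star {p x : D} (hp : IsStarProjection p)
    (h : CuntzSubequivalent p (star x * x)) :
    ∃ e : D, p * e = e ∧ e * (star x * x) * star e = p := by
  have hpp : p * p = p := hp.isIdempotentElem
  have hps : star p = p := hp.isSelfAdjoint
  obtain ⟨d, hd⟩ := h
  have hlim : Tendsto (fun n => p * (d n * (star x * x) * star (d n)) * p) atTop (𝓝 p) := by
    simpa only [hpp] using (hd.const_mul p).mul_const p
  obtain ⟨m, hm⟩ := (hlim.eventually (Metric.ball_mem_nhds p one_pos)).exists
  set c : D := p * (d m * (star x * x) * star (d m)) * p with hc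
  have hpc : p * c = c := by simp only [hc, ← mul_assoc, hpp]
  have hcp : c * p = c := by simp only [hc, mul_assoc, hpp]
  have hcs : c = (p * d m * star x) * star (p * d m * star x) := by
    simp only [hc, star_mul, star_star, hps, mul_assoc]
  let P : Unitization ℂ D := Unitization.inr p
  let C : Unitization ℂ D := Unitization.inr c
  let u : Unitization ℂ D := 1 - (P - C)
  let _ := CStarAlgebra.spectralOrder (Unitization ℂ D)
  have _ := CStarAlgebra.spectralOrderedRing (Unitization ℂ D)
  have hPP : P * P = P := by simp only [P, ← Unitization.inr_mul, hpp]
  have hPs : star P = P := by simp only [P, ← Unitization.inr_star, hps]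
  have hPC : P * C = C := by simp only [P, C, ← Unitization.inr_mul, hpc]
  have hCP : C * P = C := by simp only [P, C, ← Unitization.inr_mul, hcp]
  have hu0 : 0 ≤ u := by
    have h1 : u = star (1 - P) * (1 - P) + C := by
      simp only [u, star_sub, star_one, hPs, mul_sub, sub_mul, one_mul, mul_one, hPP]
      abel
    have h2 : 0 ≤ C := by
      simp only [C, hcs, Unitization.inr_mul, Unitization.inr_star]
      exact mul_star_self_nonneg _
    rw [h1]
    exact add_nonneg (star_mul_self_nonneg _) h2
  have hunit : IsUnit u := by
    refine isUnit_one_sub_of_norm_lt_one ?_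
    rw [← Unitization.inr_sub, Unitization.norm_inr, norm_sub_rev, ← dist_eq_norm]
    exact hm
  have hcomm : Commute u P := by
    simp only [u, Commute, SemiconjBy, sub_mul, mul_sub, one_mul, mul_one, hPP, hPC, hCP]
  have huP : u * P = C := by simp [u, sub_mul, hPP, hCP]
  set r : Unitization ℂ D := u ^ (-(1 / 2) : ℝ)
  have hrur : r * u * r = 1 :=
    CFC.conjugate_rpow_neg_one_half u (hunit.isStrictlyPositive hu0)
  have hrP : Commute r P := hcomm.cfc_nnreal _
  have hrs : star r = r := IsSelfAdjoint.of_nonneg CFC.rpow_nonneg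
  obtain ⟨k, hk⟩ : ∃ k : D, (Unitization.inr k : Unitization ℂ D) = r * P :=
    ⟨(r * P).snd, by ext <;> simp [P]⟩
  have hpk : p * k = k := by
    apply Unitization.inr_injective (R := ℂ)
    rw [Unitization.inr_mul, hk]
    change P * (r * P) = r * P
    rw [← mul_assoc, ← hrP.eq, mul_assoc, hPP]
  refine ⟨k * (p * d m), by rw [← mul_assoc, hpk], ?_⟩
  have hkck : k * (p * d m) * (star x * x) * star (k * (p * d m)) = k * c * star k := by
    simp only [hc, star_mul, hps, mul_assoc]
  rw [hkck]
  apply Unitization.inr_injective (R := ℂ)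
  rw [Unitization.inr_mul, Unitization.inr_mul, Unitization.inr_star, hk]
  change r * P * C * star (r * P) = P
  rw [star_mul, hrs, hPs, mul_assoc r P C, hPC, ← huP]
  calc r * (u * P) * (P * r) = r * u * (P * P) * r := by simp only [mul_assoc]
    _ = r * u * r * P := by rw [hPP, mul_assoc, ← hrP.eq, mul_assoc, mul_assoc, mul_assoc]
    _ = P := by rw [hrur, one_mul]

end CStar

end CuntzSubequivalent

/-- Every element of a C⋆-algebra is a limit of left multiples of itself. -/
theorem exists_seq_tendsto_mul_self {D : Type*} [NonUnitalCStarAlgebra D] (y : D) :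
    ∃ u : ℕ → D, Tendsto (fun n => u n * y) atTop (𝓝 y) := by
  let _ := CStarAlgebra.spectralOrder D
  have _ := CStarAlgebra.spectralOrderedRing D
  have hmem : y ∈ closure (Set.range fun d : D => d * y) :=
    mem_closure_of_tendsto
      ((CStarAlgebra.increasingApproximateUnit D).toIsApproximateUnit.tendsto_mul_right y)
      (Eventually.of_forall fun d => ⟨d, rfl⟩)
  obtain ⟨x, hx, hlim⟩ := mem_closure_iff_seq_limit.1 hmem
  choose d hd using hx
  exact ⟨d, by simpa only [hd] using hlim⟩

namespace CuntzSubequivalent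

variable {A : Type*} [NonUnitalCStarAlgebra A] {ι : Type*} [Fintype ι]

theorem matrix_mul_star_self_star_mul_self (z : Matrix ι ι A) :
    CuntzSubequivalent (z * star z) (star z * z) :=
  let _ := CStarAlgebra.spectralOrder A
  have _ := CStarAlgebra.spectralOrderedRing A
  mul_star_self_star_mul_self (D := CStarMatrix ι ι A) z

theorem matrix_exists_eq_mul_mul_star {p x : Matrix ι ι A} (hp : IsStarProjection p)
    (h : CuntzSubequivalent p (star x * x)) :
    ∃ e : Matrix ι ι A, p * e = e ∧ e * (star x * x) * star e = p :=
  let _ := CStarAlgebra.spectralOrder A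
  have _ := CStarAlgebra.spectralOrderedRing A
  exists_eq_mul_mul_star (D := CStarMatrix ι ι A) (p := p) (x := x)
    ⟨hp.isIdempotentElem, hp.isSelfAdjoint⟩ h

end CuntzSubequivalent

theorem Matrix.exists_seq_tendsto_mul_self {A : Type*} [NonUnitalCStarAlgebra A]
    {ι : Type*} [Fintype ι] (y : Matrix ι ι A) :
    ∃ u : ℕ → Matrix ι ι A, Tendsto (fun n => u n * y) atTop (𝓝 y) :=
  let _ := CStarAlgebra.spectralOrder A
  have _ := CStarAlgebra.spectralOrderedRing A
  _root_.exists_seq_tendsto_mul_self (D := CStarMatrix ι ι A) y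

theorem Filter.Tendsto.matrix_fromBlocks {l m n o α R : Type*} [TopologicalSpace R]
    {F : Filter α} {A : α → Matrix n l R} {B : α → Matrix n m R} {C : α → Matrix o l R}
    {D : α → Matrix o m R} {A₀ B₀ C₀ D₀} (hA : Tendsto A F (𝓝 A₀)) (hB : Tendsto B F (𝓝 B₀))
    (hC : Tendsto C F (𝓝 C₀)) (hD : Tendsto D F (𝓝 D₀)) :
    Tendsto (fun i => Matrix.fromBlocks (A i) (B i) (C i) (D i)) F
      (𝓝 (Matrix.fromBlocks A₀ B₀ C₀ D₀)) := by
  have hcont : Continuous fun q : Matrix n l R × Matrix n m R × Matrix o l R × Matrix o m R =>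
      Matrix.fromBlocks q.1 q.2.1 q.2.2.1 q.2.2.2 := by fun_prop
  exact (hcont.tendsto (A₀, B₀, C₀, D₀)).comp
    (hA.prodMk_nhds (hB.prodMk_nhds (hC.prodMk_nhds hD)))

/-- If `p` is a projection in `Mₙ(A)` and `a` is a positive element of `Mₙ(A)` with
`p ≾ a`, then for some `N` there is a positive `b ∈ M_N(A)` with
`diag(p, b)` Cuntz equivalent to `diag(a, 0_N)`. -/
theorem projection_summand_of_cuntzSubequivalent
    {A : Type*} [NonUnitalCStarAlgebra A] {n : ℕ}
    (p a : Matrix (Fin n) (Fin n) A)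
    (hp : IsSelfAdjoint p ∧ IsIdempotentElem p)
    (ha : ∃ x : Matrix (Fin n) (Fin n) A, a = star x * x)
    (h : CuntzSubequivalent p a) :
    ∃ (N : ℕ) (b : Matrix (Fin N) (Fin N) A),
      (∃ y : Matrix (Fin N) (Fin N) A, b = star y * y) ∧
      CuntzEquivalent (Matrix.fromBlocks p 0 0 b)
        (Matrix.fromBlocks a 0 0 (0 : Matrix (Fin N) (Fin N) A)) := by
  obtain ⟨x, rfl⟩ := ha
  obtain ⟨e, hpe, he⟩ := CuntzSubequivalent.matrix_exists_eq_mul_mul_star ⟨hp.2, hp.1⟩ h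
  -- `v` is a partial isometry with `v* v = p`; `v v* = q` is a projection below `x x*`.
  set v := x * star e with hv
  set q := v * star v with hq
  have hvv : star v * v = p := by
    rw [← he, hv]; simp only [star_mul, star_star, mul_assoc]
  have hvp : v * p = v := by
    rw [hv, mul_assoc, ← hp.1.star_eq, ← star_mul, hpe]
  have hqq : q * q = q := by
    rw [hq, mul_assoc, ← mul_assoc (star v) v, hvv, ← mul_assoc, hvp]
  have hqs : star q = q := by rw [hq, star_mul, star_star]
  have hqx : v * e * star x = q := by rw [hq, hv]; simp only [star_mul, star_star, mul_assoc]
  set y := star x - star x * q with hy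
  have hqy : q * star y = 0 := by
    rw [hy, star_sub, star_mul, star_star, hqs, mul_sub, ← mul_assoc, hqq, sub_self]
  have hyq : y * q = 0 := by rw [hy, sub_mul, mul_assoc, hqq, sub_self]
  have hyy : star x * v * star (star x * v) + y * star y = star x * x := by
    have h1 : star x * v * star (star x * v) = star x * q * x := by
      simp only [hq, star_mul, star_star, mul_assoc]
    have h2 : y * star y = y * x := by
      conv_lhs => rw [hy, star_sub, star_mul, star_star, hqs, ← hy]
      rw [mul_sub, ← mul_assoc, hyq, zero_mul, sub_zero]
    rw [h1, h2, hy, sub_mul, add_sub_cancel]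
  obtain ⟨w, hw⟩ := Matrix.exists_seq_tendsto_mul_self y
  obtain ⟨s, hs⟩ := Matrix.exists_seq_tendsto_mul_self (star x)
  refine ⟨n, star y * y, ⟨y, rfl⟩, ?_⟩
  let X : Matrix (Fin n ⊕ Fin n) (Fin n ⊕ Fin n) A := fromBlocks (star x) 0 0 0
  let Y : Matrix (Fin n ⊕ Fin n) (Fin n ⊕ Fin n) A := fromBlocks v 0 0 y
  let Y' : Matrix (Fin n ⊕ Fin n) (Fin n ⊕ Fin n) A := fromBlocks q 0 y 0
  let Z : Matrix (Fin n ⊕ Fin n) (Fin n ⊕ Fin n) A := fromBlocks (star x * v) y 0 0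
  have hX : X * star X = fromBlocks (star x * x) 0 0 0 := by
    simp [X, star_eq_conjTranspose, fromBlocks_conjTranspose, fromBlocks_multiply]
  have hY : star Y * Y = fromBlocks p 0 0 (star y * y) := by
    simp [Y, ← hvv, star_eq_conjTranspose, fromBlocks_conjTranspose, fromBlocks_multiply]
  have hZ : Z * star Z = fromBlocks (star x * x) 0 0 0 := by
    rw [← hyy]
    simp [Z, star_eq_conjTranspose, fromBlocks_conjTranspose, fromBlocks_multiply]
  have hY' : Y' * star Y' = Y * star Y := by
    have hyq' : y * star q = 0 := by rw [hqs, hyq]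
    have hqq' : q * star q = v * star v := by rw [hqs, hqq]
    simp only [star_eq_conjTranspose] at hqy hyq' hqq'
    simp [Y', Y, star_eq_conjTranspose, fromBlocks_conjTranspose, fromBlocks_multiply,
      hqy, hyq', hqq']
  have hYX : CuntzSubequivalent (Y' * star Y') (X * star X) := by
    refine CuntzSubequivalent.mul_star_of_tendsto
      (d := fun i => fromBlocks (v * e) 0 (s i - star x * (v * e)) 0) ?_
    simp only [X, Y', fromBlocks_multiply, mul_zero, add_zero, sub_mul, hqx, mul_assoc (star x)]
    exact tendsto_const_nhds.matrix_fromBlocks tendsto_const_nhds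
      (hs.sub_const _) tendsto_const_nhds
  have hZY : CuntzSubequivalent (Z * star Z) (Y * star Y) := by
    refine CuntzSubequivalent.mul_star_of_tendsto
      (d := fun i => fromBlocks (star x) (w i) 0 0) ?_
    simp only [Y, Z, fromBlocks_multiply, mul_zero, zero_mul, add_zero, zero_add]
    exact tendsto_const_nhds.matrix_fromBlocks hw tendsto_const_nhds tendsto_const_nhds
  have hstar := CuntzSubequivalent.matrix_mul_star_self_star_mul_self (star Y)
  rw [star_star] at hstar
  have : FirstCountableTopology (Matrix (Fin n ⊕ Fin n) (Fin n ⊕ Fin n) A) :=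
    inferInstanceAs (FirstCountableTopology (Fin n ⊕ Fin n → Fin n ⊕ Fin n → A))
  constructor
  · rw [← hY, ← hX]
    exact hstar.trans (hY' ▸ hYX)
  · rw [← hY, ← hZ]
    exact hZY.trans (CuntzSubequivalent.matrix_mul_star_self_star_mul_self Y)
end
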